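/- arXiv:2201.08767 — 3 statements merged into one kernel-verified Lean document; each statement's English description precedes it below -/
import Mathlib

section
/- Let k ≥ 1 and let G be a (finite, simple) graph on n vertices with minimum degree δ(G) ≥ kn/(k+1). Then in any k-edge-colouring of G, there exists a monochromatic matching of size at least ⌊(n + k − 1)/(k + 1)⌋. -/
open Finset in
/-- Numerical consequences of a partition whose classes have few pairs. -/
lemma partition_bounds {V L : Type*} [DecidableEq V] [Fintype L] [DecidableEq L]
    (W : Finset V) (lab : V → L) (t : ℕ)
    (h : ∑ l : L, #{w ∈ W | lab w = l} / 2 ≤ t) :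
    (∀ u ∈ W, ∀ v ∈ W, lab v ≠ lab u →
      #{w ∈ W | lab w = lab u} + #{w ∈ W | lab w = lab v} ≤ 2 * t + 2) ∧
    ∑ v ∈ W, (#{w ∈ W | lab w = lab v} - 1) ≤ 2 * t * (2 * t + 1) := by
  constructor
  · intro u _ v _ huv
    have h2 : ∑ l ∈ ({lab u, lab v} : Finset L), #{w ∈ W | lab w = l} / 2 ≤ t :=
      le_trans (Finset.sum_le_sum_of_subset (Finset.subset_univ _)) h
    rw [Finset.sum_pair (Ne.symm huv)] at h2
    omega
  · have h1 : ∑ v ∈ W, (#{w ∈ W | lab w = lab v} - 1)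
        = ∑ l : L, ∑ v ∈ W with lab v = l, (#{w ∈ W | lab w = lab v} - 1) :=
      (Finset.sum_fiberwise W lab _).symm
    have h2 : ∀ l : L, ∑ v ∈ W with lab v = l, (#{w ∈ W | lab w = lab v} - 1)
        ≤ (2 * t + 1) * (2 * (#{w ∈ W | lab w = l} / 2)) := by
      intro l
      have h3 : #{w ∈ W | lab w = l} / 2 ≤ t :=
        le_trans (Finset.single_le_sum (f := fun l => #{w ∈ W | lab w = l} / 2)
          (fun _ _ => Nat.zero_le _) (Finset.mem_univ l)) h
      have h4 : ∑ v ∈ W with lab v = l, (#{w ∈ W | lab w = lab v} - 1)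
          = ∑ v ∈ W with lab v = l, (#{w ∈ W | lab w = l} - 1) := by
        refine Finset.sum_congr rfl fun v hv => ?_
        rw [(Finset.mem_filter.1 hv).2]
      rw [h4, Finset.sum_const, smul_eq_mul]
      apply Nat.mul_le_mul <;> omega
    calc _ ≤ ∑ l : L, (2 * t + 1) * (2 * (#{w ∈ W | lab w = l} / 2)) := by
          rw [h1]; exact Finset.sum_le_sum fun l _ => h2 l
      _ = (2 * t + 1) * (2 * ∑ l : L, #{w ∈ W | lab w = l} / 2) := by
          rw [Finset.mul_sum, Finset.mul_sum]
      _ ≤ (2 * t + 1) * (2 * t) := by gcongr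
      _ = _ := by ring

/-- The join of `H` with a complete graph on `m` new vertices. -/
def joinComplete {V : Type*} (H : SimpleGraph V) (m : ℕ) : SimpleGraph (V ⊕ Fin m) where
  Adj x y := x ≠ y ∧ ∀ a b, x = Sum.inl a → y = Sum.inl b → H.Adj a b
  symm := ⟨fun x y h => ⟨h.1.symm, fun a b ha hb => (h.2 b a hb ha).symm⟩⟩
  loopless := ⟨fun x h => h.1 rfl⟩

open Finset in
/-- A perfect matching of the join yields a large matching of `H`. -/
lemma matching_of_join {V : Type*} [Fintype V] [DecidableEq V] (H : SimpleGraph V) (m : ℕ)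
    (P : (joinComplete H m).Subgraph) (hP : P.IsPerfectMatching) :
    ∃ M : Finset (Sym2 V), (∀ e ∈ M, e ∈ H.edgeSet) ∧
      (∀ e ∈ M, ∀ f ∈ M, e ≠ f → ∀ v : V, v ∈ e → v ∉ f) ∧
      Fintype.card V ≤ 2 * #M + m := by
  classical
  rw [SimpleGraph.Subgraph.isPerfectMatching_iff] at hP
  choose f hf hu using hP
  have hinv : ∀ x, f (f x) = x := fun x => (hu (f x) x (hf x).symm).symm
  let M : Finset (Sym2 V) :=
    {e | ∃ a b, e = s(a, b) ∧ P.Adj (Sum.inl a) (Sum.inl b)}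
  have hM : ∀ a b, s(a, b) ∈ M ↔ f (Sum.inl a) = Sum.inl b := by
    intro a b
    simp only [M, Finset.mem_filter, Finset.mem_univ, true_and]
    constructor
    · rintro ⟨x, y, hxy, hadj⟩
      rcases Sym2.eq_iff.1 hxy with ⟨rfl, rfl⟩ | ⟨rfl, rfl⟩
      · exact (hu _ _ hadj).symm
      · exact (hu _ _ hadj.symm).symm
    · intro h
      exact ⟨a, b, rfl, h ▸ hf _⟩
  refine ⟨M, ?_, ?_, ?_⟩
  · intro e
    induction e with
    | h a b =>
      intro h
      have h1 := hf (Sum.inl a)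
      rw [(hM a b).1 h] at h1
      exact h1.adj_sub.2 a b rfl rfl
  · intro e he g hg hne v hve hvg
    obtain ⟨a, rfl⟩ := Sym2.mem_iff_exists.1 hve
    obtain ⟨b, rfl⟩ := Sym2.mem_iff_exists.1 hvg
    apply hne
    have := ((hM _ _).1 he).symm.trans ((hM _ _).1 hg)
    rw [Sum.inl.inj this]
  · let A : Finset V := {v | ∃ w, f (Sum.inl v) = Sum.inl w}
    let B : Finset V := {v | ¬ ∃ w, f (Sum.inl v) = Sum.inl w}
    have hAB : #A + #B = Fintype.card V := by
      rw [← Finset.card_univ]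
      exact Finset.card_filter_add_card_filter_not (s := (Finset.univ : Finset V))
        (fun v => ∃ w, f (Sum.inl v) = Sum.inl w)
    have hB : #B ≤ m := by
      have h1 : ∀ v ∈ B, ∃ j : Fin m, f (Sum.inl v) = Sum.inr j := by
        intro v hv
        have := (Finset.mem_filter.1 hv).2
        rcases h : f (Sum.inl v) with w | j
        · exact absurd ⟨w, h⟩ this
        · exact ⟨j, rfl⟩
      have h2 : #(B.image fun v => f (Sum.inl v)) = #B := by
        apply Finset.card_image_of_injOn
        intro x _ y _ hxy
        have := congrArg f hxy
        simp only [hinv] at this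
        exact Sum.inl.inj this
      have h3 : (B.image fun v => f (Sum.inl v)) ⊆ (Finset.univ : Finset (Fin m)).image Sum.inr := by
        intro x hx
        obtain ⟨v, hv, rfl⟩ := Finset.mem_image.1 hx
        obtain ⟨j, hj⟩ := h1 v hv
        exact Finset.mem_image.2 ⟨j, Finset.mem_univ _, hj.symm⟩
      calc #B = _ := h2.symm
        _ ≤ _ := Finset.card_le_card h3
        _ ≤ _ := Finset.card_image_le
        _ = m := by simp
    have hA : #A ≤ 2 * #M := by
      have h1 : A ⊆ M.biUnion fun e => e.toFinset := by
        intro v hv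
        obtain ⟨w, hw⟩ := (Finset.mem_filter.1 hv).2
        exact Finset.mem_biUnion.2 ⟨s(v, w), (hM v w).2 hw, by simp⟩
      calc #A ≤ _ := Finset.card_le_card h1
        _ ≤ #M * 2 := Finset.card_biUnion_le_card_mul _ _ _ fun e _ => by
            rw [Sym2.card_toFinset]; split_ifs <;> omega
        _ = _ := by ring
    omega

open Finset in
/-- The form of the Tutte–Berge formula used below. -/
lemma tutte_berge_labels {V : Type*} [Fintype V] [DecidableEq V] (H : SimpleGraph V) (q : ℕ)
    (hq : ∀ M : Finset (Sym2 V), (∀ e ∈ M, e ∈ H.edgeSet) →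
      (∀ e ∈ M, ∀ f ∈ M, e ≠ f → ∀ v : V, v ∈ e → v ∉ f) → #M ≤ q) :
    ∃ (S : Finset V) (t : ℕ) (C : V → Finset V), #S + t = q ∧
      (∀ v, v ∉ S → v ∈ C v) ∧
      (∀ u v, u ∉ S → v ∉ S → H.Adj u v → v ∈ C u) ∧
      (∀ u v, u ∉ S → v ∉ S → v ∉ C u → #(C u) + #(C v) ≤ 2 * t + 2) ∧
      ∑ v ∈ Sᶜ, (#(C v) - 1) ≤ 2 * t * (2 * t + 1) := by
  classical
  -- it suffices to produce a labelling
  suffices hs : ∃ (S : Finset V) (n : ℕ) (lab : V → Fin n),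
      (∀ u v, u ∉ S → v ∉ S → H.Adj u v → lab v = lab u) ∧
      #S + ∑ l, #{w ∈ Sᶜ | lab w = l} / 2 ≤ q by
    obtain ⟨S, n, lab, hadj, hsum⟩ := hs
    obtain ⟨h1, h2⟩ := partition_bounds Sᶜ lab (q - #S) (by omega)
    refine ⟨S, q - #S, fun v => {w ∈ Sᶜ | lab w = lab v}, by omega, ?_, ?_, ?_, h2⟩
    · intro v hv; simp [hv]
    · intro u v hu hv huv; simp [hv, hadj u v hu hv huv]
    · intro u v hu hv huv
      exact h1 u (by simpa using hu) v (by simpa using hv) (by simpa [hv] using huv)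
  by_cases hn : Fintype.card V ≤ 2 * q + 1
  · refine ⟨∅, 1, fun _ => 0, fun _ _ _ _ _ => rfl, ?_⟩
    simp
    omega
  obtain ⟨m, hm⟩ : ∃ m, Fintype.card V = 2 * q + 2 + m := ⟨Fintype.card V - (2 * q + 2), by omega⟩
  set K := joinComplete H m with hK
  have hcard : Nat.card (V ⊕ Fin m) = 2 * (q + 1 + m) := by
    rw [Nat.card_eq_fintype_card, Fintype.card_sum, Fintype.card_fin]; omega
  have hnoP : ¬ ∃ P : K.Subgraph, P.IsPerfectMatching := by
    rintro ⟨P, hP⟩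
    obtain ⟨M, h1, h2, h3⟩ := matching_of_join H m P hP
    have := hq M h1 h2
    omega
  rw [SimpleGraph.tutte] at hnoP
  push Not at hnoP
  obtain ⟨U, hU⟩ := hnoP
  unfold SimpleGraph.IsTutteViolator at hU
  set D := ((⊤ : K.Subgraph).deleteVerts U) with hD
  have hverts : D.verts = Uᶜ := by ext x; simp [hD]
  have hDadj : ∀ x y, K.Adj x y → x ∉ U → y ∉ U → D.Adj x y := by
    intro x y h hx hy
    simp [hD, h, hx, hy]
  have hDcard : Nat.card D.verts + U.ncard = 2 * (q + 1 + m) := by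
    rw [Nat.card_coe_set_eq, hverts, ← hcard, add_comm]
    exact Set.ncard_add_ncard_compl U
  have hpar := D.coe.odd_ncard_oddComponents
  have hge : U.ncard + 2 ≤ D.coe.oddComponents.ncard := by
    rcases Nat.even_or_odd D.coe.oddComponents.ncard with h | h
    · have : ¬ Odd (Nat.card D.verts) := by rw [← hpar]; exact Nat.not_odd_iff_even.2 h
      grind
    · have := hpar.1 h
      grind
  have hinr : ∀ j : Fin m, Sum.inr j ∈ U := by
    intro j
    by_contra hj
    have hsub : Subsingleton D.coe.ConnectedComponent := by
      have hz : ∀ x : D.verts, D.coe.connectedComponentMk x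
          = D.coe.connectedComponentMk ⟨Sum.inr j, by rw [hverts]; exact hj⟩ := by
        rintro ⟨x, hx⟩
        by_cases hxj : x = Sum.inr j
        · subst hxj; rfl
        · apply SimpleGraph.ConnectedComponent.sound
          apply SimpleGraph.Adj.reachable
          have hx' : x ∉ U := by rw [hverts] at hx; exact hx
          exact hDadj _ _ ⟨hxj, fun a b _ h => by cases h⟩ hx' hj
      refine ⟨fun a b => ?_⟩
      induction a using SimpleGraph.ConnectedComponent.ind with | _ a =>
      induction b using SimpleGraph.ConnectedComponent.ind with | _ b =>
      rw [hz a, hz b]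
    have : D.coe.oddComponents.ncard ≤ 1 := Set.ncard_le_one_of_subsingleton _
    omega
  haveI : Fintype D.coe.ConnectedComponent := Fintype.ofFinite _
  let L := Option D.coe.ConnectedComponent
  let lab0 : V → L := fun v =>
    if h : Sum.inl v ∈ D.verts then some (D.coe.connectedComponentMk ⟨Sum.inl v, h⟩) else none
  let S : Finset V := {v | Sum.inl v ∈ U}
  have hmemS : ∀ v, v ∈ S ↔ Sum.inl v ∈ U := by intro v; simp [S]
  have hfib : ∀ c : D.coe.ConnectedComponent,
      #{w ∈ Sᶜ | lab0 w = some c} = c.supp.ncard := by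
    intro c
    rw [← Set.ncard_coe_finset]
    apply Set.ncard_congr (fun (v : V) (hv : v ∈ (({w ∈ Sᶜ | lab0 w = some c} : Finset V) : Set V)) =>
      (⟨Sum.inl v, by
        have : v ∉ S := by simp at hv; exact hv.1
        rw [hverts]; rwa [hmemS] at this⟩ : D.verts))
    · intro v hv
      have h1 : lab0 v = some c := by simp at hv; exact hv.2
      have h2 : Sum.inl v ∈ D.verts := by
        have : v ∉ S := by simp at hv; exact hv.1
        rw [hverts]; rwa [hmemS] at this
      simp only [lab0, h2, dite_true] at h1
      exact Option.some.inj h1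
    · intro a b ha hb hab
      exact Sum.inl.inj (congrArg Subtype.val hab)
    · rintro ⟨x, hx⟩ hxc
      have hx' : x ∉ U := by rw [hverts] at hx; exact hx
      rcases x with v | j
      · refine ⟨v, ?_, rfl⟩
        simp only [Finset.coe_filter, Finset.mem_compl, Set.mem_ofPred_eq, hmemS]
        refine ⟨hx', ?_⟩
        simp only [lab0, hx, dite_true]
        exact congrArg some hxc
      · exact absurd (hinr j) hx'
  have hnone : #{w ∈ Sᶜ | lab0 w = none} = 0 := by
    rw [Finset.card_eq_zero, Finset.filter_eq_empty_iff]
    intro v hv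
    have h2 : Sum.inl v ∈ D.verts := by
      rw [hverts]; rw [Finset.mem_compl, hmemS] at hv; exact hv
    simp [lab0, h2]
  have hUcard : U.ncard = #S + m := by
    have : U = ((S.disjSum (Finset.univ : Finset (Fin m)) : Finset (V ⊕ Fin m)) : Set (V ⊕ Fin m)) := by
      ext x
      rcases x with v | j
      · simp [hmemS]
      · simp [hinr j]
    rw [this, Set.ncard_coe_finset, Finset.card_disjSum]
    simp
  have hodd : D.coe.oddComponents.ncard = ∑ c : D.coe.ConnectedComponent, c.supp.ncard % 2 := by
    rw [Set.ncard_eq_toFinset_card', Finset.card_eq_sum_ones]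
    rw [← Finset.sum_subset (Finset.subset_univ D.coe.oddComponents.toFinset)]
    · refine Finset.sum_congr rfl fun c hc => ?_
      have : Odd c.supp.ncard := by simpa using hc
      exact (Nat.odd_iff.1 this).symm
    · intro c _ hc
      have : ¬ Odd c.supp.ncard := by simpa using hc
      exact Nat.even_iff.1 (Nat.not_odd_iff_even.1 this)
  have htot : ∑ c : D.coe.ConnectedComponent, c.supp.ncard + #S = Fintype.card V := by
    have h1 : ∑ l : L, #{w ∈ Sᶜ | lab0 w = l} = #(Sᶜ) :=
      (Finset.card_eq_sum_card_fiberwise (fun _ _ => Finset.mem_univ _)).symm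
    rw [Fintype.sum_option, hnone, zero_add] at h1
    simp only [hfib] at h1
    rw [h1, Finset.card_compl]
    have := Finset.card_le_univ S
    omega
  have hdiv : ∑ c : D.coe.ConnectedComponent, c.supp.ncard
      = 2 * ∑ c : D.coe.ConnectedComponent, c.supp.ncard / 2
        + ∑ c : D.coe.ConnectedComponent, c.supp.ncard % 2 := by
    rw [Finset.mul_sum, ← Finset.sum_add_distrib]
    exact Finset.sum_congr rfl fun c _ => (Nat.div_add_mod _ 2).symm
  let E := Fintype.equivFin L
  refine ⟨S, Fintype.card L, fun v => E (lab0 v), ?_, ?_⟩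
  · intro u v hu hv huv
    rw [hmemS] at hu hv
    have hu2 : Sum.inl u ∈ D.verts := by rw [hverts]; exact hu
    have hv2 : Sum.inl v ∈ D.verts := by rw [hverts]; exact hv
    have : lab0 v = lab0 u := by
      simp only [lab0, hu2, hv2, dite_true]
      congr 1
      apply SimpleGraph.ConnectedComponent.sound
      apply SimpleGraph.Adj.reachable
      refine hDadj _ _ ⟨?_, ?_⟩ hv hu
      · intro h; exact huv.ne (Sum.inl.inj h).symm
      · rintro a b ha hb
        rw [← Sum.inl.inj ha, ← Sum.inl.inj hb]; exact huv.symm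
    exact congrArg E this
  · have : ∑ l, #{w ∈ Sᶜ | E (lab0 w) = l} / 2
        = ∑ c : D.coe.ConnectedComponent, c.supp.ncard / 2 := by
      rw [← Equiv.sum_comp E]
      simp only [E.injective.eq_iff]
      rw [Fintype.sum_option, hnone]
      simp only [hfib]
      simp
    rw [this]
    omega

open Finset in
/-- Omidi–Raesi–Rahimi: if `G` is a graph on `n` vertices with
`δ(G) ≥ kn/(k+1)`, then any `k`-edge-colouring of `G` contains a monochromatic
matching of size at least `⌊(n + k - 1)/(k + 1)⌋`. -/
theorem stmt_7 {V : Type*} [Fintype V] [DecidableEq V] (G : SimpleGraph V)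
    [DecidableRel G.Adj] (k : ℕ) (hk : 1 ≤ k)
    (hδ : ((k : ℝ) * Fintype.card V) / (k + 1) ≤ G.minDegree)
    (c : Sym2 V → Fin k) :
    ∃ (i : Fin k) (M : Finset (Sym2 V)),
      (∀ e ∈ M, e ∈ G.edgeSet ∧ c e = i) ∧
      (∀ e ∈ M, ∀ f ∈ M, e ≠ f → ∀ v : V, v ∈ e → v ∉ f) ∧
      (Fintype.card V + k - 1) / (k + 1) ≤ M.card := by
  classical
  by_contra hcon
  push Not at hcon
  obtain ⟨q, hq⟩ : ∃ q, (Fintype.card V + k - 1) / (k + 1) = q + 1 := by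
    have := hcon ⟨0, hk⟩ ∅ (by simp) (by simp)
    exact ⟨(Fintype.card V + k - 1) / (k + 1) - 1, by omega⟩
  rw [hq] at hcon
  have hn : (k + 1) * q + 2 ≤ Fintype.card V := by
    have h1 := Nat.div_mul_le_self (Fintype.card V + k - 1) (k + 1)
    rw [hq] at h1
    have h2 : (q + 1) * (k + 1) = (k + 1) * q + k + 1 := by ring
    omega
  have hδ' : k * Fintype.card V ≤ G.minDegree * (k + 1) := by
    rw [div_le_iff₀ (by positivity)] at hδ
    exact_mod_cast hδ
  have hδq : k * q < G.minDegree := by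
    by_contra! h
    nlinarith
  let H : Fin k → SimpleGraph V := fun i =>
    { Adj := fun u v => G.Adj u v ∧ c s(u, v) = i
      symm := ⟨fun u v h => ⟨h.1.symm, by rw [Sym2.eq_swap]; exact h.2⟩⟩
      loopless := ⟨fun u h => h.1.ne rfl⟩ }
  have hTB := fun i => tutte_berge_labels (H i) q (by
    intro M h1 h2
    have := hcon i M (by
      intro e
      induction e with
      | h a b => intro he; exact h1 _ he) h2
    omega)
  choose S t C hSt hself hadj hdiff hsum using hTB
  set U : Finset V := Finset.univ.biUnion S with hU
  have hUS : ∀ v, v ∉ U → ∀ i, v ∉ S i := by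
    intro v hv i hi
    exact hv (Finset.mem_biUnion.2 ⟨i, Finset.mem_univ _, hi⟩)
  have hUcard : #U ≤ ∑ i, #(S i) := Finset.card_biUnion_le
  have hST : ∑ i, #(S i) + ∑ i, t i = k * q := by
    rw [← Finset.sum_add_distrib, Finset.sum_congr rfl fun i _ => hSt i]
    simp
  have hcompl : #Uᶜ + #U = Fintype.card V := by
    rw [add_comm]; exact Finset.card_add_card_compl U
  set T := ∑ i, t i with hT
  have hN : T + q + 2 ≤ #Uᶜ := by
    have : (k + 1) * q = k * q + q := by ring
    omega
  -- degree bound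
  have hdeg : ∀ v, v ∉ U → T < ∑ i, (#(C i v) - 1) := by
    intro v hv
    have h1 : G.neighborFinset v ⊆ U ∪ Finset.univ.biUnion fun i => (C i v).erase v := by
      intro w hw
      rw [SimpleGraph.mem_neighborFinset] at hw
      by_cases hwU : w ∈ U
      · exact Finset.mem_union_left _ hwU
      · refine Finset.mem_union_right _ (Finset.mem_biUnion.2 ⟨c s(v, w), Finset.mem_univ _, ?_⟩)
        exact Finset.mem_erase.2 ⟨hw.ne', hadj _ v w (hUS v hv _) (hUS w hwU _) ⟨hw, rfl⟩⟩
    have h2 := G.minDegree_le_degree v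
    have h3 : G.degree v ≤ #U + ∑ i, (#(C i v) - 1) := by
      rw [← SimpleGraph.card_neighborFinset_eq_degree]
      refine (Finset.card_le_card h1).trans ((Finset.card_union_le _ _).trans ?_)
      gcongr
      refine Finset.card_biUnion_le.trans (le_of_eq ?_)
      exact Finset.sum_congr rfl fun i _ => Finset.card_erase_of_mem (hself i v (hUS v hv i))
    omega
  have hpair : ∀ u, u ∉ U → ∀ v, v ∉ U → ∃ i, v ∈ C i u := by
    intro u hu v hv
    by_contra! h
    have h1 : ∑ i, (#(C i u) - 1) + ∑ i, (#(C i v) - 1) ≤ ∑ i, 2 * t i := by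
      rw [← Finset.sum_add_distrib]
      refine Finset.sum_le_sum fun i _ => ?_
      have h2 := hdiff i u v (hUS u hu i) (hUS v hv i) (h i)
      have h3 := Finset.card_pos.2 ⟨u, hself i u (hUS u hu i)⟩
      have h4 := Finset.card_pos.2 ⟨v, hself i v (hUS v hv i)⟩
      omega
    rw [← Finset.mul_sum] at h1
    have := hdeg u hu
    have := hdeg v hv
    omega
  have hlow : ∀ v ∈ Uᶜ, #Uᶜ - 1 ≤ ∑ i, (#(C i v) - 1) := by
    intro v hv
    have hv' : v ∉ U := by simpa using hv
    have h1 : Uᶜ.erase v ⊆ Finset.univ.biUnion fun i => (C i v).erase v := by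
      intro w hw
      obtain ⟨hwv, hwU⟩ := Finset.mem_erase.1 hw
      obtain ⟨i, hi⟩ := hpair v hv' w (by simpa using hwU)
      exact Finset.mem_biUnion.2 ⟨i, Finset.mem_univ _, Finset.mem_erase.2 ⟨hwv, hi⟩⟩
    rw [← Finset.card_erase_of_mem hv]
    refine (Finset.card_le_card h1).trans (Finset.card_biUnion_le.trans (le_of_eq ?_))
    exact Finset.sum_congr rfl fun i _ => Finset.card_erase_of_mem (hself i v (hUS v hv' i))
  have hfin : #Uᶜ * (#Uᶜ - 1) ≤ 2 * T * (2 * q + 1) := by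
    calc #Uᶜ * (#Uᶜ - 1) = ∑ v ∈ Uᶜ, (#Uᶜ - 1) := by simp
      _ ≤ ∑ v ∈ Uᶜ, ∑ i, (#(C i v) - 1) := Finset.sum_le_sum hlow
      _ = ∑ i, ∑ v ∈ Uᶜ, (#(C i v) - 1) := Finset.sum_comm
      _ ≤ ∑ i, ∑ v ∈ (S i)ᶜ, (#(C i v) - 1) := by
          refine Finset.sum_le_sum fun i _ => Finset.sum_le_sum_of_subset ?_
          intro v hv
          have hv' : v ∉ U := by simpa using hv
          simpa using hUS v hv' i
      _ ≤ ∑ i, 2 * t i * (2 * q + 1) := by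
          refine Finset.sum_le_sum fun i _ => (hsum i).trans ?_
          have : t i ≤ q := by have := hSt i; omega
          gcongr
      _ = _ := by rw [← Finset.sum_mul, ← Finset.mul_sum]
  obtain ⟨x, hx⟩ : ∃ x, #Uᶜ = T + q + 2 + x := ⟨#Uᶜ - (T + q + 2), by omega⟩
  rw [hx, show T + q + 2 + x - 1 = T + q + 1 + x by omega] at hfin
  zify at hfin
  nlinarith [sq_nonneg ((T : ℤ) - q), Int.natCast_nonneg T, Int.natCast_nonneg q,
    Int.natCast_nonneg x, mul_nonneg (Int.natCast_nonneg T) (Int.natCast_nonneg x),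
    mul_nonneg (Int.natCast_nonneg q) (Int.natCast_nonneg x), sq_nonneg (x : ℤ)]
end

section
/- For all integers k ≥ 3 and all ε > 0, there exist t₀ = t₀(k, ε) > 0 and n₀ = n₀(k, ε) ∈ ℕ such that the following holds: in any k-edge-colouring of the complete graph K_n with n ≥ n₀, there exist vertex-disjoint paths P₁, …, P_t with t ≤ t₀ such that all edges of P₁ ∪ ⋯ ∪ P_t have the same colour and |V(P₁) ∪ ⋯ ∪ V(P_t)| ≥ (2 − ε)n/(k + 1). -/
/-- Depth first search: at every potential value `j ≤ |W|` there is a path `L` and a set `D` of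
dead vertices without neighbours among the unvisited vertices. -/
theorem dfs_state {V : Type*} [DecidableEq V] (adj : V → V → Prop)
    (hsymm : ∀ a b, adj a b → adj b a) (W : Finset V) :
    ∀ j : ℕ, j ≤ W.card → ∃ (L : List V) (D : Finset V), L.Nodup ∧ L.IsChain adj ∧
      (∀ v ∈ L, v ∈ W) ∧ D ⊆ W ∧ (∀ v ∈ L, v ∉ D) ∧
      (∀ d ∈ D, ∀ u ∈ W, u ∉ L → u ∉ D → ¬ adj d u) ∧ L.length + 2 * D.card = j := by
  intro j
  induction j with
  | zero => intro _; exact ⟨[], ∅, by simp⟩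
  | succ j ih =>
    intro hj
    obtain ⟨L, D, hnd, hch, hLW, hDW, hLD, hno, hcard⟩ := ih (by omega)
    cases L with
    | nil =>
      have hlt : D.card < W.card := by simp at hcard; omega
      obtain ⟨u, huW, huD⟩ := Finset.exists_mem_notMem_of_card_lt_card hlt
      refine ⟨[u], D, by simp, by simp, by simpa using huW, hDW, by simpa using huD, ?_, ?_⟩
      · intro d hd v hv _ hvD
        exact hno d hd v hv (by simp) hvD
      · simp at hcard ⊢; omega
    | cons x l =>
      by_cases h : ∃ u ∈ W, u ∉ x :: l ∧ u ∉ D ∧ adj x u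
      · obtain ⟨u, huW, huL, huD, hxu⟩ := h
        refine ⟨u :: x :: l, D, List.nodup_cons.2 ⟨huL, hnd⟩,
          List.isChain_cons_cons.2 ⟨hsymm _ _ hxu, hch⟩, ?_, hDW, ?_, ?_, ?_⟩
        · intro v hv
          rcases List.mem_cons.1 hv with rfl | hv
          · exact huW
          · exact hLW v hv
        · intro v hv
          rcases List.mem_cons.1 hv with rfl | hv
          · exact huD
          · exact hLD v hv
        · intro d hd v hv hvL hvD
          exact hno d hd v hv (fun h => hvL (List.mem_cons_of_mem _ h)) hvD
        · simp only [List.length_cons] at hcard ⊢; omega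
      · push Not at h
        have hxD : x ∉ D := hLD x (by simp)
        refine ⟨l, insert x D, (List.nodup_cons.1 hnd).2, ?_, ?_, ?_, ?_, ?_, ?_⟩
        · exact hch.tail
        · intro v hv; exact hLW v (List.mem_cons_of_mem _ hv)
        · exact Finset.insert_subset (hLW x (by simp)) hDW
        · intro v hv hvD
          rcases Finset.mem_insert.1 hvD with rfl | hvD
          · exact (List.nodup_cons.1 hnd).1 hv
          · exact hLD v (List.mem_cons_of_mem _ hv) hvD
        · intro d hd v hv hvL hvD
          have hvx : v ≠ x := fun h => hvD (by simp [h])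
          have hvD' : v ∉ D := fun h => hvD (Finset.mem_insert_of_mem h)
          have hvL' : v ∉ x :: l := by simp [hvx, hvL]
          rcases Finset.mem_insert.1 hd with rfl | hd
          · exact h v hv hvL' hvD'
          · exact hno d hd v hv hvL' hvD'
        · rw [Finset.card_insert_of_notMem hxD]
          simp only [List.length_cons] at hcard; omega

theorem alternate {V : Type*} [DecidableEq V] (A B : Finset V) (hAB : Disjoint A B) :
    ∀ L : List V, (∀ v ∈ L, v ∈ A ∪ B) →
      L.IsChain (fun a b => (a ∈ A ∧ b ∈ B) ∨ (a ∈ B ∧ b ∈ A)) →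
      L.countP (· ∈ A) ≤ L.countP (· ∈ B) + 1 ∧ L.countP (· ∈ B) ≤ L.countP (· ∈ A) + 1 ∧
      (∀ x ∈ L.head?, (x ∈ A → L.countP (· ∈ B) ≤ L.countP (· ∈ A)) ∧
        (x ∈ B → L.countP (· ∈ A) ≤ L.countP (· ∈ B))) := by
  intro L
  induction L with
  | nil => simp
  | cons x l ih =>
    intro hmem hch
    obtain ⟨h1, h2, h3⟩ := ih (fun v hv => hmem v (List.mem_cons_of_mem _ hv)) hch.tail
    have hd : ∀ v, v ∈ A → v ∈ B → False := fun v ha hb => Finset.disjoint_left.1 hAB ha hb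
    have hx := hmem x (by simp)
    simp only [List.countP_cons]
    cases l with
    | nil =>
      rcases Finset.mem_union.1 hx with hx | hx
      · have : x ∉ B := fun h => hd x hx h
        simp [hx, this]
      · have : x ∉ A := fun h => hd x h hx
        simp [hx, this]
    | cons y l =>
      have h3' := h3 y (by simp)
      rcases (List.isChain_cons_cons.1 hch).1 with ⟨hxA, hy⟩ | ⟨hxB, hy⟩
      · have hxB : x ∉ B := fun h => hd x hxA h
        have := h3'.2 hy
        simp only [hxA, hxB, decide_true, decide_false, List.head?_cons, Option.mem_def,
          Option.some.injEq]
        refine ⟨by simpa using this, by simp; omega, ?_⟩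
        rintro _ rfl
        exact ⟨fun _ => by simp; omega, fun h => absurd h hxB⟩
      · have hxA : x ∉ A := fun h => hd x h hxB
        have := h3'.1 hy
        simp only [hxA, hxB, decide_true, decide_false, List.head?_cons, Option.mem_def,
          Option.some.injEq]
        refine ⟨by simp; omega, by simpa using this, ?_⟩
        rintro _ rfl
        exact ⟨fun h => absurd h hxA, fun _ => by simp; omega⟩

/-- A balanced bipartite graph without large bipartite holes has an almost spanning path. -/
theorem long_path {V : Type*} [DecidableEq V] (G : SimpleGraph V) (A B : Finset V)
    (hAB : Disjoint A B) (hc : A.card = B.card) (h : ℕ)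
    (hole : ∀ A' ⊆ A, ∀ B' ⊆ B, h ≤ A'.card → h ≤ B'.card → ∃ a ∈ A', ∃ b ∈ B', G.Adj a b) :
    ∃ L : List V, L.Nodup ∧ L.IsChain G.Adj ∧ (∀ v ∈ L, v ∈ A ∪ B) ∧
      A.card + B.card ≤ L.length + 4 * h + 1 := by
  classical
  obtain ⟨L, D, hnd, hch, hLW, hDW, hLD, hno, hcard⟩ := dfs_state
    (fun a b => G.Adj a b ∧ ((a ∈ A ∧ b ∈ B) ∨ (a ∈ B ∧ b ∈ A)))
    (fun a b hab => ⟨hab.1.symm, by tauto⟩) (A ∪ B) _ le_rfl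
  refine ⟨L, hnd, hch.imp fun a b hab => hab.1, hLW, ?_⟩
  obtain ⟨h1, h2, -⟩ := alternate A B hAB L hLW (hch.imp fun a b hab => hab.2)
  have cnt : ∀ S : Finset V, L.countP (· ∈ S) = (L.toFinset ∩ S).card := by
    intro S
    rw [List.countP_eq_length_filter, ← List.toFinset_card_of_nodup (hnd.filter _)]
    congr 1
    ext v; simp
  rw [cnt, cnt] at h1 h2
  have hd : ∀ v, v ∈ A → v ∈ B → False := fun v ha hb => Finset.disjoint_left.1 hAB ha hb
  -- decomposition of a set
  have dec : ∀ S ⊆ A ∪ B, S.card = (L.toFinset ∩ S).card + (D ∩ S).card +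
      (S \ (L.toFinset ∪ D)).card := by
    intro S _
    rw [← Finset.card_union_of_disjoint, ← Finset.card_union_of_disjoint]
    · congr 1; ext v; simp; tauto
    · rw [Finset.disjoint_left]; intro v; simp; tauto
    · rw [Finset.disjoint_left]; intro v; simp; intro a b c; exact absurd c (hLD v a)
  have dA := dec A Finset.subset_union_left
  have dB := dec B Finset.subset_union_right
  have dL : L.length = (L.toFinset ∩ A).card + (L.toFinset ∩ B).card := by
    rw [← List.toFinset_card_of_nodup hnd, ← Finset.card_union_of_disjoint]
    · congr 1; ext v
      have := hLW v
      simp at this ⊢; tauto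
    · rw [Finset.disjoint_left]; intro v; simp; intro _ a _; exact hd v a
  have dD : D.card = (D ∩ A).card + (D ∩ B).card := by
    rw [← Finset.card_union_of_disjoint]
    · congr 1; ext v
      have := @hDW v
      simp at this ⊢; tauto
    · rw [Finset.disjoint_left]; intro v; simp; intro _ a _; exact hd v a
  rw [Finset.card_union_of_disjoint hAB] at hcard
  have k1 : (D ∩ A).card < h ∨ (B \ (L.toFinset ∪ D)).card < h := by
    by_contra! hh
    obtain ⟨a, ha, b, hb, hab⟩ := hole (D ∩ A) Finset.inter_subset_right
      (B \ (L.toFinset ∪ D)) Finset.sdiff_subset hh.1 hh.2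
    simp at ha hb
    exact hno a ha.1 b (by simp [hb.1]) (by tauto) (by tauto) ⟨hab, Or.inl ⟨ha.2, hb.1⟩⟩
  have k2 : (D ∩ B).card < h ∨ (A \ (L.toFinset ∪ D)).card < h := by
    by_contra! hh
    obtain ⟨b, hb, a, ha, hab⟩ := hole (A \ (L.toFinset ∪ D)) Finset.sdiff_subset
      (D ∩ B) Finset.inter_subset_right hh.2 hh.1
    simp at ha hb
    exact hno a ha.1 b (by simp [hb.1]) (by tauto) (by tauto) ⟨hab.symm, Or.inr ⟨ha.2, hb.1⟩⟩
  omega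

/-- Koenig's theorem, in relational form. -/
theorem koenig {ι : Type} [Fintype ι] [DecidableEq ι] (R : ι → ι → Prop) :
    ∃ (X Y M : Finset ι) (f : ι → ι), (∀ i j, R i j → i ∈ X ∨ j ∈ Y) ∧
      Set.InjOn f M ∧ (∀ i ∈ M, R i (f i)) ∧ X.card + Y.card ≤ M.card := by
  classical
  let N : ι → Finset ι := fun i => Finset.univ.filter (R i)
  obtain ⟨S, -, hS⟩ := Finset.exists_min_image (Finset.univ : Finset (Finset ι))
    (fun S => (S.biUnion N).card + Sᶜ.card) ⟨∅, by simp⟩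
  have h0 := hS ∅ (by simp)
  simp at h0
  set d := Fintype.card ι - ((S.biUnion N).card + Sᶜ.card) with hd
  let t : ι → Finset (ι ⊕ Fin d) := fun i => (N i).disjSum Finset.univ
  have hall : ∀ s : Finset ι, s.card ≤ (s.biUnion t).card := by
    intro s
    rcases s.eq_empty_or_nonempty with rfl | ⟨i0, hi0⟩
    · simp
    have e : s.biUnion t = (s.biUnion N).disjSum Finset.univ := by
      ext x
      rcases x with x | x
      · simp [t]
      · simp [t]; exact ⟨i0, hi0⟩
    rw [e, Finset.card_disjSum, Finset.card_univ, Fintype.card_fin]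
    have := hS s (by simp)
    have h2 := Finset.card_add_card_compl s
    omega
  obtain ⟨g, hg, hgt⟩ := (Finset.all_card_le_biUnion_card_iff_exists_injective t).1 hall
  let M := Finset.univ.filter fun i => (g i).isLeft
  have hM : ∀ i ∈ M, ∃ j, g i = Sum.inl j := by
    intro i hi
    exact Sum.isLeft_iff.1 (Finset.mem_filter.1 hi).2
  let f : ι → ι := fun i => (g i).elim id (fun _ => i)
  refine ⟨Sᶜ, S.biUnion N, M, f, ?_, ?_, ?_, ?_⟩
  · intro i j hij
    by_cases hi : i ∈ S
    · right; exact Finset.mem_biUnion.2 ⟨i, hi, by simp [N, hij]⟩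
    · left; simpa using hi
  · intro i hi j hj hij
    obtain ⟨a, ha⟩ := hM i hi
    obtain ⟨b, hb⟩ := hM j hj
    apply hg
    simp only [f, ha, hb] at hij
    rw [ha, hb]; simpa using hij
  · intro i hi
    obtain ⟨a, ha⟩ := hM i hi
    have := hgt i
    simp only [f, ha]
    rw [ha] at this
    simpa [t, N] using this
  · have hc : Mᶜ.card ≤ d := by
      have : (Mᶜ.image g).card ≤ ((Finset.univ : Finset (Fin d)).map ⟨Sum.inr, Sum.inr_injective⟩ :
          Finset (ι ⊕ Fin d)).card := by
        apply Finset.card_le_card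
        intro x hx
        obtain ⟨i, hi, rfl⟩ := Finset.mem_image.1 hx
        have : ¬ (g i).isLeft = true := by
          simpa [M] using hi
        rcases hgi : g i with a | a
        · simp [hgi] at this
        · simp
      rw [Finset.card_image_of_injective _ hg] at this
      simpa using this
    have h2 := Finset.card_add_card_compl M
    omega

open Finset SzemerediRegularity in
theorem bad_pairs {α : Type*} [DecidableEq α] [Fintype α] [Nonempty α] (G : SimpleGraph α)
    [DecidableRel G.Adj] (P : Finpartition (univ : Finset α)) (ε : ℝ)
    (hε : 0 < ε) (hP : P.IsEquipartition)
    (hPε : P.IsUniform G (ε / 8)) (hP' : 4 / ε ≤ #P.parts) :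
    (#((univ ×ˢ univ).filter fun ((x, y) : α × α) ↦
          G.Adj x y ∧ ¬(G.regularityReduced P (ε / 8) (ε / 4)).Adj x y) : ℝ)
      ≤ 2 * ε * (Fintype.card α) ^ 2 := by
  let A := (P.nonUniforms G (ε / 8)).biUnion fun (U, V) ↦ U ×ˢ V
  let B := P.parts.biUnion offDiag
  let C := (P.sparsePairs G (ε / 4)).biUnion fun (U, V) ↦ G.interedges U V
  have hA : (#A : ℝ) ≤ 4 * (ε / 8) * (Fintype.card α) ^ 2 :=
    (hP.sum_nonUniforms_lt univ_nonempty (by positivity) hPε).le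
  have hB : (#B : ℝ) ≤ ε / 2 * (Fintype.card α) ^ 2 := hP.card_biUnion_offDiag_le hε hP'
  have hC : (#C : ℝ) ≤ 4 * (ε / 4) * (Fintype.card α) ^ 2 :=
    hP.card_interedges_sparsePairs_le (G := G) (ε := ε / 4) (by positivity)
  calc
    _ ≤ (#(A ∪ B ∪ C) : ℝ) := by gcongr; exact SimpleGraph.unreduced_edges_subset
    _ ≤ #(A ∪ B) + #C := mod_cast (card_union_le _ _)
    _ ≤ #A + #B + #C := by gcongr; exact mod_cast card_union_le _ _
    _ ≤ 4 * (ε / 8) * (Fintype.card α) ^ 2 + ε / 2 * (Fintype.card α) ^ 2 +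
        4 * (ε / 4) * (Fintype.card α) ^ 2 := by gcongr
    _ = _ := by ring

theorem exists_halves {V : Type*} [DecidableEq V] (U : Finset V) (s : ℕ) (h : 2 * s ≤ U.card) :
    ∃ L R : Finset V, L ⊆ U ∧ R ⊆ U ∧ Disjoint L R ∧ L.card = s ∧ R.card = s := by
  obtain ⟨L, hL, hLs⟩ := Finset.exists_subset_card_eq (s := U) (n := s) (by omega)
  obtain ⟨R, hR, hRs⟩ := Finset.exists_subset_card_eq (s := U \ L) (n := s)
    (by rw [Finset.card_sdiff_of_subset hL]; omega)
  exact ⟨L, R, hL, hR.trans Finset.sdiff_subset,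
    Finset.disjoint_of_subset_right hR Finset.disjoint_sdiff, hLs, hRs⟩

theorem structure_lemma (δ : ℝ) (hδ : 0 < δ) (hδ1 : δ ≤ 1) :
    ∃ t₀ n₀ : ℕ, ∀ n : ℕ, n₀ ≤ n → ∀ G : SimpleGraph (Fin n),
      ∃ (X Y : Finset (Fin n)) (t : ℕ) (P : Fin t → List (Fin n)), t ≤ t₀ ∧
        (∀ j, (P j).Nodup ∧ (P j).IsChain G.Adj) ∧
        (∀ j j' : Fin t, j ≠ j' → ∀ v : Fin n, v ∈ P j → v ∉ P j') ∧
        ((X.card : ℝ) + Y.card ≤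
          ((Finset.univ.biUnion fun j : Fin t => (P j).toFinset).card : ℝ) + δ * n) ∧
        ∃ Bad : Finset (Fin n × Fin n), (Bad.card : ℝ) ≤ δ * n ^ 2 ∧
          ∀ u v, G.Adj u v → (u, v) ∉ Bad → (u ∈ X ∨ v ∈ Y) ∧ (v ∈ X ∨ u ∈ Y) := by
  classical
  set e := δ / 2 with he
  have he0 : 0 < e := by positivity
  set l := ⌈4 / e⌉₊ with hl
  set K := SzemerediRegularity.bound (e / 8) l with hK
  refine ⟨K, max (max l 1) ⌈16 * K / δ⌉₊, ?_⟩
  intro n hn G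
  have hn1 : 1 ≤ n := le_trans (le_trans (le_max_right _ _) (le_max_left _ _)) hn
  have hnl : l ≤ n := le_trans (le_trans (le_max_left _ _) (le_max_left _ _)) hn
  have hnK : 16 * K ≤ δ * n := by
    have h1 : 16 * K / δ ≤ n :=
      (Nat.le_ceil _).trans (by exact_mod_cast (le_max_right _ _).trans hn)
    rw [div_le_iff₀ hδ] at h1
    linarith
  have : Nonempty (Fin n) := ⟨⟨0, hn1⟩⟩
  obtain ⟨Q, hQe, hQl, hQK, hQu⟩ := szemeredi_regularity G (ε := e / 8) (l := l) (by positivity)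
    (by simpa using hnl)
  have hbad := bad_pairs G Q e he0 hQe hQu ((Nat.le_ceil _).trans (by exact_mod_cast hQl))
  simp only [Fintype.card_fin] at hbad
  set m := Q.parts.card with hm
  set q := n / m with hq
  have hm0 : 0 < m := by
    rw [hm, Finset.card_pos]
    exact Q.parts_nonempty (Finset.univ_nonempty.ne_empty)
  have hqlow : ∀ U ∈ Q.parts, q ≤ U.card := by
    intro U hU
    have := hQe.average_le_card_part hU
    simpa using this
  have hqup : ∀ U ∈ Q.parts, U.card ≤ q + 1 := by
    intro U hU
    have := hQe.card_part_le_average_add_one hU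
    simpa using this
  let R : Q.parts → Q.parts → Prop := fun U V => (U : Finset (Fin n)) ≠ V ∧
    G.IsUniform (e / 8) (U : Finset (Fin n)) V ∧ e / 4 ≤ (G.edgeDensity (U : Finset (Fin n)) V : ℝ)
  have hRsymm : ∀ U V, R U V → R V U := by
    rintro U V ⟨h1, h2, h3⟩
    exact ⟨h1.symm, h2.symm, by rwa [SimpleGraph.edgeDensity_comm]⟩
  obtain ⟨X', Y', M, f, hcov, hinj, hMR, hcard⟩ := koenig R
  have hpd : ∀ U V : Q.parts, ∀ v, v ∈ (U : Finset (Fin n)) → v ∈ (V : Finset (Fin n)) → U = V := by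
    intro U V v h1 h2
    exact Subtype.ext (Q.disjoint.elim U.2 V.2 (Finset.not_disjoint_iff.2 ⟨v, h1, h2⟩))
  have hhalf : ∀ U : Q.parts, ∃ L R : Finset (Fin n), L ⊆ U.1 ∧ R ⊆ U.1 ∧ Disjoint L R ∧
      L.card = q / 2 ∧ R.card = q / 2 := fun U =>
    exists_halves U.1 (q / 2) (by have := hqlow U.1 U.2; omega)
  choose HL HR hHL hHR hHd hHLc hHRc using hhalf
  set h := ⌈((q : ℝ) + 1) * (e / 8)⌉₊ with hh
  have hpath : ∀ U : Q.parts, ∃ L : List (Fin n), U ∈ M → (L.Nodup ∧ L.IsChain G.Adj ∧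
      (∀ v ∈ L, v ∈ HL U ∪ HR (f U)) ∧ (HL U).card + (HR (f U)).card ≤ L.length + 4 * h + 1) := by
    intro U
    by_cases hU : U ∈ M
    · obtain ⟨hne, huni, hden⟩ := hMR U hU
      obtain ⟨L, hL⟩ := long_path G (HL U) (HR (f U)) (by
          rw [Finset.disjoint_left]
          intro v h1 h2
          exact hne (congrArg _ (hpd U (f U) v (hHL _ h1) (hHR _ h2))))
        (by rw [hHLc, hHRc]) h (by
          intro A' hA' B' hB' hA hB
          have key : ∀ (W : Q.parts) (S : Finset (Fin n)), h ≤ S.card →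
              (W.1.card : ℝ) * (e / 8) ≤ S.card := by
            intro W S hS
            have h1 : (W.1.card : ℝ) ≤ q + 1 := by exact_mod_cast hqup W.1 W.2
            calc (W.1.card : ℝ) * (e / 8) ≤ (q + 1) * (e / 8) := by gcongr
              _ ≤ h := Nat.le_ceil _
              _ ≤ S.card := by exact_mod_cast hS
          have := huni (hA'.trans (hHL _)) (hB'.trans (hHR _)) (key _ _ hA) (key _ _ hB)
          have hpos : 0 < (G.edgeDensity A' B' : ℝ) := by
            have := (abs_lt.1 this).1
            linarith
          by_contra! hno
          have hz : G.interedges A' B' = ∅ := by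
            ext ⟨a, b⟩
            simp only [SimpleGraph.mem_interedges_iff, Finset.notMem_empty, iff_false]
            rintro ⟨ha, hb, hab⟩
            exact hno a ha b hb hab
          rw [← SimpleGraph.card_interedges_div_card, hz] at hpos
          simp at hpos)
      exact ⟨L, fun _ => hL⟩
    · exact ⟨[], fun h => absurd h hU⟩
  choose pth hpth using hpath
  let eqv : Fin M.card ≃ M := M.equivFin.symm
  have hMm : M.card ≤ m := by
    have := Finset.card_le_univ M
    simpa using this
  have hdisj : ∀ U ∈ M, ∀ W ∈ M, U ≠ W → ∀ v, v ∈ pth U → v ∉ pth W := by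
    intro U hU W hW hUW v hv hv'
    have h1 := (hpth U hU).2.2.1 v hv
    have h2 := (hpth W hW).2.2.1 v hv'
    have cross : ∀ A B : Q.parts, v ∈ HL A → v ∈ HR B → False := by
      intro A B hA hB
      obtain rfl := hpd A B v (hHL _ hA) (hHR _ hB)
      exact Finset.disjoint_left.1 (hHd A) hA hB
    rcases Finset.mem_union.1 h1 with h1 | h1 <;> rcases Finset.mem_union.1 h2 with h2 | h2
    · exact hUW (hpd _ _ v (hHL _ h1) (hHL _ h2))
    · exact cross _ _ h1 h2
    · exact cross _ _ h2 h1
    · exact hUW (hinj hU hW (hpd _ _ v (hHR _ h1) (hHR _ h2)))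
  have hne' : ∀ j j' : Fin M.card, j ≠ j' → (eqv j).1 ≠ (eqv j').1 := by
    intro j j' hjj heq
    exact hjj (eqv.injective (Subtype.ext heq))
  refine ⟨X'.biUnion Subtype.val, Y'.biUnion Subtype.val, M.card, fun j => pth (eqv j).1,
    hMm.trans hQK, ?_, ?_, ?_, ?_⟩
  · intro j
    exact ⟨(hpth _ (eqv j).2).1, (hpth _ (eqv j).2).2.1⟩
  · intro j j' hjj v hv
    exact hdisj _ (eqv j).2 _ (eqv j').2 (hne' j j' hjj) v hv
  · have hX : ∀ Z : Finset Q.parts, (Z.biUnion Subtype.val).card ≤ Z.card * (q + 1) :=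
      fun Z => Finset.card_biUnion_le_card_mul _ _ _ fun U _ => hqup U.1 U.2
    have hXY : (X'.biUnion Subtype.val).card + (Y'.biUnion Subtype.val).card
        ≤ M.card * (q + 1) := by
      calc _ ≤ X'.card * (q + 1) + Y'.card * (q + 1) := add_le_add (hX _) (hX _)
        _ = (X'.card + Y'.card) * (q + 1) := by ring
        _ ≤ _ := by gcongr
    have hcov2 : M.card * (q + 1) ≤
        (Finset.univ.biUnion fun j : Fin M.card => (pth (eqv j).1).toFinset).card
          + M.card * (4 * h + 3) := by
      rw [Finset.card_biUnion]
      · have : ∀ j : Fin M.card, q + 1 ≤ (pth (eqv j).1).toFinset.card + (4 * h + 3) := by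
          intro j
          have h4 := (hpth _ (eqv j).2).2.2.2
          rw [hHLc, hHRc] at h4
          rw [List.toFinset_card_of_nodup (hpth _ (eqv j).2).1]
          omega
        have h5 := Finset.sum_le_sum fun (j : Fin M.card) (_ : j ∈ Finset.univ) => this j
        rw [Finset.sum_const, Finset.sum_add_distrib, Finset.sum_const] at h5
        simpa only [Finset.card_univ, Fintype.card_fin, smul_eq_mul] using h5
      · intro j _ j' _ hjj
        refine Finset.disjoint_left.2 ?_
        intro v hv hv'
        exact hdisj _ (eqv j).2 _ (eqv j').2 (hne' j j' hjj) v (by simpa using hv)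
          (by simpa using hv')
    have h6 : ((X'.biUnion Subtype.val).card : ℝ) + (Y'.biUnion Subtype.val).card ≤
        (Finset.univ.biUnion fun j : Fin M.card => (pth (eqv j).1).toFinset).card
          + M.card * (4 * h + 3) := by exact_mod_cast hXY.trans hcov2
    have h7 : (h : ℝ) ≤ (q + 1) * (e / 8) + 1 := (Nat.ceil_lt_add_one (by positivity)).le
    have h8 : (m : ℝ) * q ≤ n := by exact_mod_cast Nat.mul_div_le n m
    have h9 : (m : ℝ) ≤ K := by exact_mod_cast hQK
    have h10 : (M.card : ℝ) * (4 * h + 3) ≤ δ * n := by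
      calc (M.card : ℝ) * (4 * h + 3) ≤ m * (4 * ((q + 1) * (e / 8) + 1) + 3) := by gcongr
        _ = (m * q) * (e / 2) + m * (e / 2) + 7 * m := by ring
        _ ≤ n * (e / 2) + K * (1 / 2) + 7 * K := by
          gcongr
          linarith
        _ ≤ δ * n := by
          have : (n : ℝ) * (e / 2) = δ * n / 4 := by rw [he]; ring
          have hK0 : (0 : ℝ) ≤ K := by positivity
          linarith
    linarith
  · refine ⟨_, hbad.trans (le_of_eq (by rw [he]; ring)), ?_⟩
    intro u v huv hnb
    have hred : (G.regularityReduced Q (e / 8) (e / 4)).Adj u v := by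
      by_contra hr
      exact hnb (by simp only [Finset.mem_filter]; exact ⟨by simp, huv, hr⟩)
    obtain ⟨-, U, hU, W, hW, huU, hvW, hne, huni, hden⟩ := hred
    have hR : R ⟨U, hU⟩ ⟨W, hW⟩ := ⟨hne, huni, hden⟩
    constructor
    · rcases hcov _ _ hR with h1 | h1
      · left; exact Finset.mem_biUnion.2 ⟨_, h1, huU⟩
      · right; exact Finset.mem_biUnion.2 ⟨_, h1, hvW⟩
    · rcases hcov _ _ (hRsymm _ _ hR) with h1 | h1
      · left; exact Finset.mem_biUnion.2 ⟨_, h1, hvW⟩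
      · right; exact Finset.mem_biUnion.2 ⟨_, h1, huU⟩

theorem final_count (k n : ℕ) (hk : 1 ≤ k) (c : Sym2 (Fin n) → Fin k)
    (X Y : Fin k → Finset (Fin n)) (Bad : Fin k → Finset (Fin n × Fin n)) (y μ β : ℝ)
    (hy : 0 < y) (hXY : ∀ i, ((X i).card : ℝ) + (Y i).card ≤ μ)
    (hBad : ∀ i, ((Bad i).card : ℝ) ≤ β) (hβ : k * β + n ≤ y * y)
    (hcov : ∀ u v, u ≠ v → (u, v) ∉ Bad (c s(u, v)) →
      (u ∈ X (c s(u, v)) ∨ v ∈ Y (c s(u, v))) ∧ (v ∈ X (c s(u, v)) ∨ u ∈ Y (c s(u, v)))) :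
    2 * (n : ℝ) ≤ (k + 1) * μ + 2 * k * y := by
  classical
  let S : Fin k → Finset (Fin n) := fun i => X i ∩ Y i
  let A : Finset (Fin n) := Finset.univ.filter fun v => ∀ i, v ∉ S i
  let T : Fin k → Finset (Fin n) := fun i => A.filter fun v => v ∈ X i ∨ v ∈ Y i
  let Z : Fin k → Finset (Fin n) := fun i => A.filter fun v => ∀ j, v ∈ T j → j = i
  have hk1 : (1 : ℝ) ≤ k := by exact_mod_cast hk
  have hST : ∀ i, 2 * ((S i).card : ℝ) + (T i).card ≤ μ := by
    intro i
    refine le_trans ?_ (hXY i)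
    have h1 : (X i ∪ Y i).card + (X i ∩ Y i).card = (X i).card + (Y i).card :=
      Finset.card_union_add_card_inter _ _
    have h2 : (S i).card + (T i).card ≤ (X i ∪ Y i).card := by
      rw [← Finset.card_union_of_disjoint]
      · apply Finset.card_le_card
        intro v
        simp only [S, T, A, Finset.mem_union, Finset.mem_inter, Finset.mem_filter]
        tauto
      · rw [Finset.disjoint_left]
        intro v hv hv'
        have := (Finset.mem_filter.1 (Finset.mem_filter.1 hv').1).2 i
        exact this hv
    have h3 : 2 * (S i).card + (T i).card ≤ (X i).card + (Y i).card := by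
      have : (S i).card = (X i ∩ Y i).card := rfl
      omega
    exact_mod_cast h3
  have hμ : 0 ≤ μ := le_trans (by positivity) (hST ⟨0, hk⟩)
  have hn : (n : ℝ) ≤ A.card + ∑ i, ((S i).card : ℝ) := by
    have h1 : (Finset.univ : Finset (Fin n)) ⊆ A ∪ Finset.univ.biUnion S := by
      intro v _
      by_cases hv : ∀ i, v ∉ S i
      · exact Finset.mem_union_left _ (by simp [A, hv])
      · push Not at hv
        obtain ⟨i, hi⟩ := hv
        exact Finset.mem_union_right _ (Finset.mem_biUnion.2 ⟨i, by simp, hi⟩)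
    have h2 := (Finset.card_le_card h1).trans (Finset.card_union_le _ _)
    have h3 : (Finset.univ.biUnion S).card ≤ ∑ i, (S i).card := Finset.card_biUnion_le
    rw [Finset.card_univ, Fintype.card_fin] at h2
    exact_mod_cast h2.trans (Nat.add_le_add_left h3 _)
  by_cases hcase : ∃ i, y ≤ (Z i).card
  · obtain ⟨i, hi⟩ := hcase
    have hsub : (Z i) ×ˢ (A \ T i) ⊆ (Finset.univ.biUnion Bad) ∪
        (Finset.univ : Finset (Fin n)).image (fun v => (v, v)) := by
      rintro ⟨u, v⟩ huv
      obtain ⟨hu, hv⟩ := Finset.mem_product.1 huv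
      simp only at hu hv
      by_cases huv' : u = v
      · subst huv'; exact Finset.mem_union_right _ (by simp)
      · apply Finset.mem_union_left
        refine Finset.mem_biUnion.2 ⟨c s(u, v), by simp, ?_⟩
        by_contra hb
        have hc := hcov u v huv' hb
        set j := c s(u, v) with hj
        obtain ⟨huA, huZ⟩ := Finset.mem_filter.1 hu
        obtain ⟨hvA, hvT⟩ := Finset.mem_sdiff.1 hv
        have hu2 := (Finset.mem_filter.1 huA).2 j
        have hv2 := (Finset.mem_filter.1 hvA).2 j
        simp only [S, Finset.mem_inter] at hu2 hv2
        have huT : u ∈ T j := Finset.mem_filter.2 ⟨huA, by tauto⟩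
        have hvT' : v ∈ T j := Finset.mem_filter.2 ⟨hvA, by tauto⟩
        have := huZ j huT
        rw [this] at hvT'
        exact hvT hvT'
    have h1 : (((Z i).card * (A \ T i).card : ℕ) : ℝ) ≤ k * β + n := by
      rw [← Finset.card_product]
      have h2 := (Finset.card_le_card hsub).trans (Finset.card_union_le _ _)
      have h3 : (Finset.univ.biUnion Bad).card ≤ ∑ i, (Bad i).card := Finset.card_biUnion_le
      have h4 : ((Finset.univ : Finset (Fin n)).image (fun v => (v, v))).card ≤ n := by
        simpa using Finset.card_image_le (s := (Finset.univ : Finset (Fin n)))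
          (f := fun v => (v, v))
      have h5 : (∑ i, ((Bad i).card : ℝ)) ≤ k * β := by
        simpa using Finset.sum_le_sum fun i (_ : i ∈ Finset.univ) => hBad i
      have h6 : ((((Z i) ×ˢ (A \ T i)).card : ℕ) : ℝ) ≤ (∑ i, ((Bad i).card : ℝ)) + n := by
        exact_mod_cast h2.trans (add_le_add h3 h4)
      linarith
    have h7 : ((A \ T i).card : ℝ) ≤ y := by
      have h8 : y * ((A \ T i).card : ℝ) ≤ y * y := by
        calc y * ((A \ T i).card : ℝ) ≤ (Z i).card * (A \ T i).card := by gcongr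
          _ ≤ k * β + n := by exact_mod_cast h1
          _ ≤ _ := hβ
      exact le_of_mul_le_mul_left h8 hy
    have h9 : (A.card : ℝ) ≤ (T i).card + y := by
      have : (A \ T i).card + (T i).card = A.card :=
        Finset.card_sdiff_add_card_eq_card (Finset.filter_subset _ _)
      have : ((A \ T i).card : ℝ) + (T i).card = A.card := by exact_mod_cast this
      linarith
    have h10 : 2 * ∑ j, ((S j).card : ℝ) + 2 * (T i).card ≤ k * μ + μ := by
      have h11 : ∀ j ∈ (Finset.univ : Finset (Fin k)),
          2 * ((S j).card : ℝ) + (if j = i then 2 * ((T i).card : ℝ) else 0) ≤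
            μ + (if j = i then μ else 0) := by
        intro j _
        have := hST j
        split_ifs with hji
        · subst hji
          have : (0 : ℝ) ≤ (S j).card := by positivity
          linarith
        · have : (0 : ℝ) ≤ (T j).card := by positivity
          linarith
      have h12 := Finset.sum_le_sum h11
      rw [Finset.sum_add_distrib, Finset.sum_add_distrib, ← Finset.mul_sum] at h12
      simpa using h12
    nlinarith
  · push Not at hcase
    have h1 : 2 * (A.card : ℝ) ≤ ∑ i, ((T i).card : ℝ) + 2 * ∑ i, ((Z i).card : ℝ) := by
      have h2 : ∀ v ∈ A, 2 ≤ (Finset.univ.filter fun i => v ∈ T i).card +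
          2 * (Finset.univ.filter fun i => v ∈ Z i).card := by
        intro v hv
        by_cases hz : ∃ i, v ∈ Z i
        · obtain ⟨i, hi⟩ := hz
          have : 0 < (Finset.univ.filter fun i => v ∈ Z i).card :=
            Finset.card_pos.2 ⟨i, by simp [hi]⟩
          omega
        · push Not at hz
          have hz' : ∀ i, ∃ j, v ∈ T j ∧ j ≠ i := by
            intro i
            by_contra! hcon
            exact hz i (Finset.mem_filter.2 ⟨hv, hcon⟩)
          obtain ⟨a, ha, -⟩ := hz' ⟨0, hk⟩
          obtain ⟨b, hb, hba⟩ := hz' a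
          have : 1 < (Finset.univ.filter fun i => v ∈ T i).card :=
            Finset.one_lt_card.2 ⟨b, by simp [hb], a, by simp [ha], hba⟩
          omega
      have h3 := Finset.sum_le_sum h2
      rw [Finset.sum_add_distrib, ← Finset.mul_sum] at h3
      have dc : ∀ F : Fin k → Finset (Fin n), (∀ i, F i ⊆ A) →
          ∑ v ∈ A, (Finset.univ.filter fun i => v ∈ F i).card = ∑ i, (F i).card := by
        intro F hF
        have := Finset.sum_card_bipartiteAbove_eq_sum_card_bipartiteBelow (s := A)
          (t := (Finset.univ : Finset (Fin k))) (fun v i => v ∈ F i)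
        refine this.trans (Finset.sum_congr rfl fun i _ => ?_)
        congr 1
        ext v
        simp only [Finset.bipartiteBelow, Finset.mem_filter]
        exact ⟨fun h => h.2, fun h => ⟨hF i h, h⟩⟩
      rw [dc T fun i => Finset.filter_subset _ _, dc Z fun i => Finset.filter_subset _ _,
        Finset.sum_const, smul_eq_mul, mul_comm] at h3
      exact_mod_cast h3
    have h4 : ∑ i, ((Z i).card : ℝ) ≤ k * y := by
      simpa using Finset.sum_le_sum fun i (_ : i ∈ Finset.univ) => (hcase i).le
    have h5 : 2 * ∑ i, ((S i).card : ℝ) + ∑ i, ((T i).card : ℝ) ≤ k * μ := by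
      have := Finset.sum_le_sum fun i (_ : i ∈ Finset.univ) => hST i
      rw [Finset.sum_add_distrib, ← Finset.mul_sum] at this
      simpa using this
    nlinarith

/-- For all `k ≥ 3` and `ε > 0`, there are `t₀ > 0` and `n₀` such that any
`k`-edge-colouring of `K_n` with `n ≥ n₀` contains at most `t₀` vertex-disjoint
paths, all of the same colour, covering at least `(2 - ε)n/(k + 1)` vertices. -/
theorem stmt_8 (k : ℕ) (hk : 3 ≤ k) (ε : ℝ) (hε : 0 < ε) :
    ∃ t₀ n₀ : ℕ, 0 < t₀ ∧ ∀ n : ℕ, n₀ ≤ n → ∀ c : Sym2 (Fin n) → Fin k,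
      ∃ (t : ℕ) (P : Fin t → List (Fin n)) (i : Fin k),
        t ≤ t₀ ∧
        (∀ j : Fin t, (P j).Nodup ∧
          (P j).Chain' (fun a b => a ≠ b ∧ c s(a, b) = i)) ∧
        (∀ j j' : Fin t, j ≠ j' → ∀ v : Fin n, v ∈ P j → v ∉ P j') ∧
        (2 - ε) * n / (k + 1) ≤
          ((Finset.univ.biUnion fun j : Fin t => (P j).toFinset).card : ℝ) := by
  have hk3 : (3 : ℝ) ≤ k := by exact_mod_cast hk
  set η : ℝ := min ε 1 / (8 * k) with hη
  have hm0 : 0 < min ε 1 := lt_min hε one_pos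
  have hη0 : 0 < η := by positivity
  have hηk : 8 * k * η = min ε 1 := by rw [hη]; field_simp
  have hη1 : η ≤ 1 := by
    have : min ε 1 ≤ 1 := min_le_right _ _
    nlinarith
  set δ : ℝ := η * η / (2 * k) with hδ
  have hδ0 : 0 < δ := by positivity
  have hδk : 2 * (k * δ) = η * η := by rw [hδ]; field_simp
  have hδ1 : δ ≤ 1 := by nlinarith
  obtain ⟨t₀, n₀, hmain⟩ := structure_lemma δ hδ0 hδ1
  refine ⟨t₀ + 1, max (max n₀ 1) ⌈2 / (η * η)⌉₊, by omega, ?_⟩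
  intro n hn c
  have hn0 : n₀ ≤ n := le_trans (le_trans (le_max_left _ _) (le_max_left _ _)) hn
  have hn1 : 1 ≤ n := le_trans (le_trans (le_max_right _ _) (le_max_left _ _)) hn
  have hn1' : (1 : ℝ) ≤ n := by exact_mod_cast hn1
  have hn2 : 2 ≤ n * (η * η) := by
    have h1 : 2 / (η * η) ≤ (n : ℝ) :=
      (Nat.le_ceil _).trans (by exact_mod_cast (le_max_right _ _).trans hn)
    rwa [div_le_iff₀ (by positivity)] at h1
  let G : Fin k → SimpleGraph (Fin n) := fun i =>
    { Adj := fun a b => a ≠ b ∧ c s(a, b) = i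
      symm := ⟨fun a b h => ⟨h.1.symm, by rw [Sym2.eq_swap]; exact h.2⟩⟩
      loopless := ⟨fun a h => h.1 rfl⟩ }
  have hG := fun i => hmain n hn0 (G i)
  choose X Y t P ht hP hdis hcov Bad hBad hcover using hG
  by_contra hcon
  have hlt : ∀ i, ((Finset.univ.biUnion fun j : Fin (t i) => (P i j).toFinset).card : ℝ)
      < (2 - ε) * n / (k + 1) := by
    intro i
    by_contra! hge
    exact hcon ⟨t i, P i, i, (ht i).trans (Nat.le_succ _), hP i, hdis i, hge⟩
  have hfin := final_count k n (by omega) c X Y Bad (η * n) ((2 - ε) * n / (k + 1) + δ * n)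
    (δ * n ^ 2) (by positivity) (fun i => (hcov i).trans (by linarith [hlt i])) hBad
    (by
      have : (n : ℝ) * 2 ≤ n * (n * (η * η)) := by gcongr
      have h2 : 2 * (k * (δ * n ^ 2)) = η * η * n ^ 2 := by rw [← hδk]; ring
      nlinarith)
    (fun u v huv hb => hcover (c s(u, v)) u v ⟨huv, rfl⟩ hb)
  have e1 : ((k : ℝ) + 1) * ((2 - ε) * n / (k + 1) + δ * n) = (2 - ε) * n + (k + 1) * δ * n := by
    field_simp
  rw [e1] at hfin
  have h3 : ((k : ℝ) + 1) * δ ≤ η := by nlinarith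
  have h4 : ((k : ℝ) + 1) * δ + 2 * k * η < ε := by
    have : min ε 1 ≤ ε := min_le_left _ _
    nlinarith
  nlinarith
end

section
/- Let V and W be infinite disjoint sets with V ∪ W = ℕ and let the complete bipartite graph K_{V,W} be 2-edge-coloured. Let A ⊆ V and B ⊆ W be infinite sets such that every a ∈ A satisfies that N₁(a) ∩ B is finite and every b ∈ B satisfies that N₁(b) ∩ A is finite. Then there exists a one-way infinite path of colour 2 whose vertex set is exactly A ∪ B. -/
open Filter

/-- Upper density of a set of positive integers:
`limsup_{n→∞} |A ∩ {1,…,n}| / n`. -/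
noncomputable def upperDensity (A : Set ℕ+) : ℝ :=
  Filter.limsup (fun n : ℕ => (Nat.card {a : ℕ+ // a ∈ A ∧ (a : ℕ) ≤ n} : ℝ) / n) Filter.atTop

/-- Adjacency in the complete bipartite graph with parts `V` and `W`. -/
def bipAdj (V W : Set ℕ+) (x y : ℕ+) : Prop :=
  (x ∈ V ∧ y ∈ W) ∨ (x ∈ W ∧ y ∈ V)

/-- Adjacency in the complete graph on the positive integers. -/
def completeAdj (x y : ℕ+) : Prop := x ≠ y

/-- `P` is the vertex set of a (finite or one-way infinite) path of colour `i`
in the graph with adjacency `Adj`, whose edges are coloured by `c`. -/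
def IsMonoPath {k : ℕ} (Adj : ℕ+ → ℕ+ → Prop) (c : Sym2 ℕ+ → Fin k) (i : Fin k)
    (P : Set ℕ+) : Prop :=
  (∃ (n : ℕ) (f : Fin n → ℕ+), Function.Injective f ∧
    (∀ (j : ℕ) (h : j + 1 < n),
      Adj (f ⟨j, Nat.lt_of_succ_lt h⟩) (f ⟨j + 1, h⟩) ∧
      c s(f ⟨j, Nat.lt_of_succ_lt h⟩, f ⟨j + 1, h⟩) = i) ∧
    P = Set.range f) ∨
  (∃ f : ℕ → ℕ+, Function.Injective f ∧
    (∀ j : ℕ, Adj (f j) (f (j + 1)) ∧ c s(f j, f (j + 1)) = i) ∧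
    P = Set.range f)

/-- Good (reversed) finite paths. -/
def GoodPath (S : Set ℕ+) (R : ℕ+ → ℕ+ → Prop) (l : List ℕ+) : Prop :=
  l ≠ [] ∧ l.Nodup ∧ (∀ x ∈ l, x ∈ S) ∧ l.IsChain R

lemma pick_fresh (B : Set ℕ+) (hB : B.Infinite) (p : ℕ+ → Prop) (hp : {b | b ∈ B ∧ ¬ p b}.Finite)
    (q : ℕ+ → Prop) (hq : {b | b ∈ B ∧ ¬ q b}.Finite) (l : List ℕ+) :
    ∃ b ∈ B, p b ∧ q b ∧ b ∉ l := by
  obtain ⟨b, hb, hn⟩ := (hB.sdiff ((hp.union hq).union l.finite_toSet)).nonempty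
  refine ⟨b, hb, ?_⟩
  simp only [Set.mem_union, Set.mem_ofPred_eq, not_or, not_and, not_not] at hn
  exact ⟨hn.1.1 hb, hn.1.2 hb, hn.2⟩

lemma extend_aux (A B : Set ℕ+) (R : ℕ+ → ℕ+ → Prop) (hs : ∀ x y, R x y → R y x)
    (hA : A.Infinite) (hB : B.Infinite)
    (h1 : ∀ a ∈ A, {b | b ∈ B ∧ ¬ R a b}.Finite)
    (h2 : ∀ b ∈ B, {a | a ∈ A ∧ ¬ R b a}.Finite)
    (x : ℕ+) (l : List ℕ+) (hl : GoodPath (A ∪ B) R (x :: l)) (hx : x ∈ A)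
    (t : ℕ+) (ht : t ∈ A ∪ B) (htl : t ∉ x :: l) :
    ∃ l', GoodPath (A ∪ B) R (l' ++ (x :: l)) ∧ t ∈ l' := by
  obtain ⟨-, hnd, hmem, hch⟩ := hl
  rcases ht with ht | ht
  · obtain ⟨b, hb, hb1, hb2, hb3⟩ := pick_fresh B hB (R x) (h1 x hx) (R t) (h1 t ht) (t :: x :: l)
    refine ⟨[t, b], ⟨by simp, ?_, ?_, ?_⟩, by simp⟩
    · simp at *; grind
    · simp at *; grind
    · simp only [List.cons_append, List.nil_append, List.isChain_cons_cons]
      exact ⟨hb2, hs _ _ hb1, hch⟩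
  · obtain ⟨a, ha, ha1, -, ha3⟩ := pick_fresh A hA (R t) (h2 t ht) (R t) (h2 t ht) (t :: x :: l)
    obtain ⟨b, hb, hb1, hb2, hb3⟩ :=
      pick_fresh B hB (R x) (h1 x hx) (R a) (h1 a ha) (a :: t :: x :: l)
    refine ⟨[t, a, b], ⟨by simp, ?_, ?_, ?_⟩, by simp⟩
    · simp at *; grind
    · simp at *; grind
    · simp only [List.cons_append, List.nil_append, List.isChain_cons_cons]
      exact ⟨ha1, hb2, hs _ _ hb1, hch⟩

lemma extend_path (A B : Set ℕ+) (R : ℕ+ → ℕ+ → Prop) (hs : ∀ x y, R x y → R y x)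
    (hA : A.Infinite) (hB : B.Infinite)
    (h1 : ∀ a ∈ A, {b | b ∈ B ∧ ¬ R a b}.Finite)
    (h2 : ∀ b ∈ B, {a | a ∈ A ∧ ¬ R b a}.Finite)
    (l : List ℕ+) (hl : GoodPath (A ∪ B) R l)
    (t : ℕ+) (ht : t ∈ A ∪ B) (htl : t ∉ l) :
    ∃ l', GoodPath (A ∪ B) R (l' ++ l) ∧ t ∈ l' := by
  match l, hl with
  | [], hl => exact absurd rfl hl.1
  | x :: l, hl =>
    rcases hl.2.2.1 x (by simp) with hx | hx
    · exact extend_aux A B R hs hA hB h1 h2 x l hl hx t ht htl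
    · rw [Set.union_comm] at hl ht ⊢
      exact extend_aux B A R hs hB hA h2 h1 x l hl hx t ht htl

lemma path_of_extend (S : Set ℕ+) (R : ℕ+ → ℕ+ → Prop) (hs : ∀ x y, R x y → R y x)
    (hS : S.Infinite)
    (he : ∀ l, GoodPath S R l → ∀ t ∈ S, t ∉ l → ∃ l', GoodPath S R (l' ++ l) ∧ t ∈ l') :
    ∃ f : ℕ → ℕ+, Function.Injective f ∧ (∀ j, R (f j) (f (j + 1))) ∧ Set.range f = S := by
  have step : ∀ (n : ℕ+) (l : {l // GoodPath S R l}), ∃ l' : {l // GoodPath S R l},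
      l.1 <:+ l'.1 ∧ l.1.length < l'.1.length ∧ (n ∈ S → n ∈ l'.1) := by
    rintro n ⟨l, hl⟩
    obtain ⟨s, hsS, hsl⟩ := (hS.sdiff l.finite_toSet).nonempty
    obtain ⟨l1, hl1, hm⟩ := he l hl s hsS hsl
    have hlen : 0 < l1.length := List.length_pos_of_mem hm
    by_cases hn : n ∈ S ∧ n ∉ l1 ++ l
    · obtain ⟨l2, hl2, hm2⟩ := he _ hl1 n hn.1 hn.2
      exact ⟨⟨_, hl2⟩, ⟨l2 ++ l1, by simp⟩, by simp; omega, fun _ => by simp [hm2]⟩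
    · exact ⟨⟨_, hl1⟩, ⟨l1, rfl⟩, by simp; omega, fun h => by
        by_contra h'
        exact hn ⟨h, h'⟩⟩
  choose g hg using step
  obtain ⟨s, hsS⟩ := hS.nonempty
  let L : ℕ → {l // GoodPath S R l} := fun n =>
    Nat.rec ⟨[s], by simp, by simp, by simpa using hsS, by simp⟩ (fun n l => g n.succPNat l) n
  have hL : ∀ n, (L n).1 <:+ (L (n+1)).1 ∧ (L n).1.length < (L (n+1)).1.length ∧
      (n.succPNat ∈ S → n.succPNat ∈ (L (n+1)).1) := fun n => hg n.succPNat (L n)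
  have hmono : ∀ m n, m ≤ n → (L m).1.reverse <+: (L n).1.reverse := by
    intro m n h
    induction n, h using Nat.le_induction with
    | base => exact List.prefix_refl _
    | succ n _ ih => exact ih.trans (List.reverse_prefix.2 (hL n).1)
  have hlen : ∀ n, n < (L n).1.reverse.length := by
    intro n
    induction n with
    | zero => simp [L]
    | succ n ih =>
      have := (hL n).2.1
      simp only [List.length_reverse] at *
      omega
  let f : ℕ → ℕ+ := fun n => (L n).1.reverse[n]'(hlen n)
  have key : ∀ m n (h : n < (L m).1.reverse.length), (L m).1.reverse[n] = f n := by
    intro m n h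
    rcases le_total m n with hmn | hmn
    · exact (hmono m n hmn).getElem h
    · exact ((hmono n m hmn).getElem (hlen n)).symm
  have hlt : ∀ m n, m ≤ n → m < (L n).1.reverse.length := fun m n h => h.trans_lt (hlen n)
  refine ⟨f, ?_, ?_, ?_⟩
  · intro i j hij
    have hi := hlt i (max i j) (le_max_left _ _)
    have hj := hlt j (max i j) (le_max_right _ _)
    rw [← key _ i hi, ← key _ j hj] at hij
    exact ((List.nodup_reverse.2 (L (max i j)).2.2.1).getElem_inj_iff).1 hij
  · intro j
    have hc : (L (j+1)).1.reverse.IsChain R := by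
      rw [List.isChain_reverse]
      exact (L (j+1)).2.2.2.2.imp (fun a b h => hs _ _ h)
    have := List.isChain_iff_getElem.1 hc j (hlen _)
    have e1 := key (j+1) j (hlt _ _ (Nat.le_succ j))
    have e2 := key (j+1) (j+1) (hlen _)
    exact e1 ▸ e2 ▸ this
  · ext x
    constructor
    · rintro ⟨n, rfl⟩
      exact (L n).2.2.2.1 _ (List.mem_reverse.1 (List.getElem_mem _))
    · intro hx
      have h := (hL x.natPred).2.2
      rw [PNat.succPNat_natPred] at h
      obtain ⟨i, hi, hxi⟩ := List.getElem_of_mem (List.mem_reverse.2 (h hx))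
      exact ⟨i, (key (x.natPred + 1) i hi).symm.trans hxi⟩

/-- If `A ⊆ V` and `B ⊆ W` are infinite and every vertex of `A` (resp. `B`)
has only finitely many colour-1 neighbours in `B` (resp. `A`), then there is a
one-way infinite path of colour 2 whose vertex set is exactly `A ∪ B`.
(Colour 1 is `(0 : Fin 2)` and colour 2 is `(1 : Fin 2)`.) -/
theorem stmt_13 (V W : Set ℕ+) (hV : V.Infinite) (hW : W.Infinite)
    (hdisj : Disjoint V W) (hunion : V ∪ W = Set.univ)
    (c : Sym2 ℕ+ → Fin 2) (A B : Set ℕ+) (hA : A ⊆ V) (hB : B ⊆ W)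
    (hAinf : A.Infinite) (hBinf : B.Infinite)
    (h1 : ∀ a ∈ A, {b | b ∈ B ∧ c s(a, b) = 0}.Finite)
    (h2 : ∀ b ∈ B, {a | a ∈ A ∧ c s(b, a) = 0}.Finite) :
    ∃ f : ℕ → ℕ+, Function.Injective f ∧
      (∀ j : ℕ, bipAdj V W (f j) (f (j + 1)) ∧ c s(f j, f (j + 1)) = 1) ∧
      Set.range f = A ∪ B := by
  have hs : ∀ x y, (bipAdj V W x y ∧ c s(x, y) = 1) → (bipAdj V W y x ∧ c s(y, x) = 1) := by
    rintro x y ⟨h, h'⟩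
    refine ⟨?_, by rwa [Sym2.eq_swap]⟩
    unfold bipAdj at *
    tauto
  have h01 : ∀ z : Fin 2, z ≠ 1 → z = 0 := by decide
  refine path_of_extend (A ∪ B) (fun x y => bipAdj V W x y ∧ c s(x, y) = 1) hs
    (hAinf.mono Set.subset_union_left) ?_
  refine extend_path A B _ hs hAinf hBinf ?_ ?_
  · intro a ha
    refine (h1 a ha).subset ?_
    rintro b ⟨hb, hn⟩
    exact ⟨hb, h01 _ fun h => hn ⟨Or.inl ⟨hA ha, hB hb⟩, h⟩⟩
  · intro b hb
    refine (h2 b hb).subset ?_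
    rintro a ⟨ha, hn⟩
    exact ⟨ha, h01 _ fun h => hn ⟨Or.inr ⟨hB hb, hA ha⟩, h⟩⟩
end
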